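/- Let G = (V ∪ ℒ, D) be a latent-factor graph that is LF-HTC-identifiable, i.e., there is an enumeration v_1, …, v_d of V together with triples (Y_i, Z_i, H_i), each satisfying the latent-factor half-trek criterion with respect to v_i, such that Z_i ∪ (Y_i ∩ htr_{H_i}(Z_i ∪ {v_i})) ⊆ {v_1, …, v_{i−1}} for every i. Then G is rationally identifiable: every edge in D_V is rationally identifiable, and moreover every entry Ω_{ij} of the latent covariance matrix Ω = Ω_diag + Γ^⊤Γ is recoverable by a rational formula in the entries of Σ on the complement of the zero set of a nonzero polynomial in the parameters (via Ω = (I_d − Λ)^⊤ Σ (I_d − Λ)). -/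

import Mathlib

open scoped Classical
open Matrix

namespace LFG

variable {V L : Type*} [DecidableEq V] [DecidableEq L]

/-- Observed parents of a node `v`: nodes `w` with `w → v` in `D_V`. -/
def paV (DV : Finset (V × V)) (v : V) : Finset V :=
  (DV.filter fun e => e.2 = v).image Prod.fst

/-- Latent parents of a set `W` of observed nodes. -/
def paL (DLV : Finset (L × V)) (W : Finset V) : Finset L :=
  (DLV.filter fun e => e.2 ∈ W).image Prod.fst

/-- Observed children of a set `H` of latent nodes. -/
def chL (DLV : Finset (L × V)) (H : Finset L) : Finset V :=
  (DLV.filter fun e => e.1 ∈ H).image Prod.snd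

/-- A latent-factor half-trek: either a directed path
`source → x₁ → ⋯ → xₙ → target` (when `latent = none`, with node list
`source :: tail`), or `source ← h → x₁ → ⋯ → xₙ → target`
(when `latent = some h`, with observed node list `tail ≠ []`).
Trivial half-treks (`latent = none`, `tail = []`) are allowed. -/
structure HalfTrek (DV : Finset (V × V)) (DLV : Finset (L × V)) where
  source : V
  latent : Option L
  tail : List V
  chain : List.Chain' (fun a b => (a, b) ∈ DV) tail
  src_edge : latent = none → ∀ x ∈ tail.head?, (source, x) ∈ DV
  latent_src : ∀ h, latent = some h → (h, source) ∈ DLV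
  latent_head : ∀ h, latent = some h → ∃ x, tail.head? = some x ∧ (h, x) ∈ DLV

variable {DV : Finset (V × V)} {DLV : Finset (L × V)}

/-- The target of a half-trek. -/
def HalfTrek.target (t : HalfTrek DV DLV) : V := t.tail.getLastD t.source

/-- Observed part of the left-hand side of a half-trek. -/
def HalfTrek.leftV (t : HalfTrek DV DLV) : Finset V := {t.source}

/-- Latent node of a half-trek (both on its left- and right-hand side). -/
def HalfTrek.lats (t : HalfTrek DV DLV) : Finset L := t.latent.toFinset

/-- Observed part of the right-hand side of a half-trek. -/
def HalfTrek.rightV (t : HalfTrek DV DLV) : Finset V :=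
  match t.latent with
  | none => insert t.source t.tail.toFinset
  | some _ => t.tail.toFinset

/-- The half-trek avoids all latent nodes in `H`. -/
def HalfTrek.Avoids (t : HalfTrek DV DLV) (H : Finset L) : Prop :=
  ∀ h, t.latent = some h → h ∉ H

/-- `w` is half-trek reachable from `u` while avoiding `H` (for distinct `u ≠ w`). -/
def HtrFrom (DV : Finset (V × V)) (DLV : Finset (L × V)) (H : Finset L) (u w : V) : Prop :=
  u ≠ w ∧ ∃ t : HalfTrek DV DLV, t.source = u ∧ t.target = w ∧ t.Avoids H

/-- `w ∈ htr_H(U)`. -/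
def HtrReach (DV : Finset (V × V)) (DLV : Finset (L × V)) (H : Finset L)
    (U : Finset V) (w : V) : Prop :=
  ∃ u ∈ U, HtrFrom DV DLV H u w

/-- Two half-treks have no sided intersection. -/
def NSI (t₁ t₂ : HalfTrek DV DLV) : Prop :=
  Disjoint t₁.leftV t₂.leftV ∧ Disjoint t₁.lats t₂.lats ∧ Disjoint t₁.rightV t₂.rightV

/-- A system of latent-factor half-treks with no sided intersection from `Y` to `T`,
indexed by targets. -/
def IsHTSystem (DV : Finset (V × V)) (DLV : Finset (L × V)) (Y T : Finset V)
    (f : V → HalfTrek DV DLV) : Prop :=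
  (∀ b ∈ T, (f b).target = b) ∧
  T.image (fun b => (f b).source) = Y ∧
  ∀ b₁ ∈ T, ∀ b₂ ∈ T, b₁ ≠ b₂ → NSI (f b₁) (f b₂)

/-- The triple `(Y, Z, H)` satisfies the latent-factor half-trek criterion (LF-HTC)
with respect to `v`. -/
def SatisfiesLFHTC (DV : Finset (V × V)) (DLV : Finset (L × V)) (v : V)
    (Y Z : Finset V) (H : Finset L) : Prop :=
  v ∉ Y ∧ v ∉ Z ∧
  Y.card = (paV DV v).card + H.card ∧
  Z.card = H.card ∧
  Disjoint Z (paV DV v) ∧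
  Disjoint Y (insert v Z) ∧
  (paL DLV Y ∩ paL DLV (insert v Z) ⊆ H) ∧
  ∃ f : V → HalfTrek DV DLV,
    IsHTSystem DV DLV Y (Z ∪ paV DV v) f ∧
    ∀ z ∈ Z, ∃ h ∈ H, (f z).latent = some h ∧ (f z).tail = [z]

section Matrices

variable [Fintype V] [Fintype L]

/-- The observed covariance matrix `Σ = (I-Λ)^{-⊤} (Ω_diag + Γ^⊤Γ) (I-Λ)^{-1}`. -/
noncomputable def SigmaMat (Λ : Matrix V V ℝ) (Γ : Matrix L V ℝ) (ω : V → ℝ) :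
    Matrix V V ℝ :=
  ((1 - Λ)ᵀ)⁻¹ * (Matrix.diagonal ω + Γᵀ * Γ) * (1 - Λ)⁻¹

/-- The parameters `(Λ, Γ, Ω_diag)` belong to `ℝ^{D_V}_reg × ℝ^{D_{ℒV}} × diag⁺_d`. -/
def GoodParams (DV : Finset (V × V)) (DLV : Finset (L × V))
    (Λ : Matrix V V ℝ) (Γ : Matrix L V ℝ) (ω : V → ℝ) : Prop :=
  (∀ a b : V, (a, b) ∉ DV → Λ a b = 0) ∧
  IsUnit (1 - Λ) ∧
  (∀ h a, (h, a) ∉ DLV → Γ h a = 0) ∧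
  (∀ a, 0 < ω a)

/-- Index type for the free parameter coordinates of `(Λ, Γ, Ω_diag)`. -/
abbrev ParamVar (DV : Finset (V × V)) (DLV : Finset (L × V)) : Type _ :=
  {e : V × V // e ∈ DV} ⊕ {e : L × V // e ∈ DLV} ⊕ V

/-- Evaluation of the parameter coordinates. -/
def evalParam (DV : Finset (V × V)) (DLV : Finset (L × V))
    (Λ : Matrix V V ℝ) (Γ : Matrix L V ℝ) (ω : V → ℝ) : ParamVar DV DLV → ℝ
  | Sum.inl e => Λ e.1.1 e.1.2
  | Sum.inr (Sum.inl e) => Γ e.1.1 e.1.2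
  | Sum.inr (Sum.inr a) => ω a

/-- Evaluation of the entries of `Σ`. -/
noncomputable def sigmaEval (Λ : Matrix V V ℝ) (Γ : Matrix L V ℝ) (ω : V → ℝ) :
    V × V → ℝ := fun e => SigmaMat Λ Γ ω e.1 e.2

/-- The direct effect `λ_{wv}` (the edge `w → v`) is rationally identifiable. -/
def RatIdent (DV : Finset (V × V)) (DLV : Finset (L × V)) (w v : V) : Prop :=
  ∃ (p q : MvPolynomial (V × V) ℝ) (g : MvPolynomial (ParamVar DV DLV) ℝ),
    g ≠ 0 ∧
    ∀ (Λ : Matrix V V ℝ) (Γ : Matrix L V ℝ) (ω : V → ℝ),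
      GoodParams DV DLV Λ Γ ω →
      MvPolynomial.eval (evalParam DV DLV Λ Γ ω) g ≠ 0 →
      MvPolynomial.eval (sigmaEval Λ Γ ω) q ≠ 0 ∧
      Λ w v * MvPolynomial.eval (sigmaEval Λ Γ ω) q
        = MvPolynomial.eval (sigmaEval Λ Γ ω) p

/-- The entry `Ω_{ij}` of the latent covariance matrix is rationally identifiable. -/
def OmegaIdent (DV : Finset (V × V)) (DLV : Finset (L × V)) (i j : V) : Prop :=
  ∃ (p q : MvPolynomial (V × V) ℝ) (g : MvPolynomial (ParamVar DV DLV) ℝ),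
    g ≠ 0 ∧
    ∀ (Λ : Matrix V V ℝ) (Γ : Matrix L V ℝ) (ω : V → ℝ),
      GoodParams DV DLV Λ Γ ω →
      MvPolynomial.eval (evalParam DV DLV Λ Γ ω) g ≠ 0 →
      MvPolynomial.eval (sigmaEval Λ Γ ω) q ≠ 0 ∧
      (Matrix.diagonal ω + Γᵀ * Γ) i j * MvPolynomial.eval (sigmaEval Λ Γ ω) q
        = MvPolynomial.eval (sigmaEval Λ Γ ω) p

end Matrices

end LFG

open LFG

namespace LFG

/-- A function of the parameters is given by a rational formula in the entries of `Σ` outside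
the zero set of a nonzero polynomial in the parameters. -/
def Ident {V L : Type*} [DecidableEq V] [Fintype V] [Fintype L]
    (DV : Finset (V × V)) (DLV : Finset (L × V))
    (F : Matrix V V ℝ → Matrix L V ℝ → (V → ℝ) → ℝ) : Prop :=
  ∃ (p q : MvPolynomial (V × V) ℝ) (g : MvPolynomial (ParamVar DV DLV) ℝ),
    g ≠ 0 ∧
    ∀ (Λ : Matrix V V ℝ) (Γ : Matrix L V ℝ) (ω : V → ℝ),
      GoodParams DV DLV Λ Γ ω →
      MvPolynomial.eval (evalParam DV DLV Λ Γ ω) g ≠ 0 →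
      MvPolynomial.eval (sigmaEval Λ Γ ω) q ≠ 0 ∧
      F Λ Γ ω * MvPolynomial.eval (sigmaEval Λ Γ ω) q
        = MvPolynomial.eval (sigmaEval Λ Γ ω) p

namespace Ident

variable {V L : Type*} [DecidableEq V] [Fintype V] [Fintype L]
  {DV : Finset (V × V)} {DLV : Finset (L × V)}
  {F G X : Matrix V V ℝ → Matrix L V ℝ → (V → ℝ) → ℝ}

lemma congr (hF : Ident DV DLV F)
    (h : ∀ Λ Γ ω, GoodParams DV DLV Λ Γ ω → G Λ Γ ω = F Λ Γ ω) : Ident DV DLV G := by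
  obtain ⟨p, q, g, hg, H⟩ := hF
  refine ⟨p, q, g, hg, fun Λ Γ ω hgood hne => ?_⟩
  rw [h Λ Γ ω hgood]
  exact H Λ Γ ω hgood hne

lemma const (c : ℝ) : Ident DV DLV (fun _ _ _ => c) :=
  ⟨MvPolynomial.C c, 1, 1, one_ne_zero, fun Λ Γ ω _ _ => by simp⟩

lemma sigma (a b : V) : Ident DV DLV (fun Λ Γ ω => SigmaMat Λ Γ ω a b) :=
  ⟨MvPolynomial.X (a, b), 1, 1, one_ne_zero, fun Λ Γ ω _ _ => by simp [sigmaEval]⟩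

lemma add (hF : Ident DV DLV F) (hG : Ident DV DLV G) :
    Ident DV DLV (fun Λ Γ ω => F Λ Γ ω + G Λ Γ ω) := by
  obtain ⟨p, q, g, hg, H⟩ := hF
  obtain ⟨p', q', g', hg', H'⟩ := hG
  refine ⟨p * q' + p' * q, q * q', g * g', mul_ne_zero hg hg', fun Λ Γ ω hgood hne => ?_⟩
  rw [map_mul] at hne
  obtain ⟨h1, h2⟩ := H Λ Γ ω hgood (left_ne_zero_of_mul hne)
  obtain ⟨h3, h4⟩ := H' Λ Γ ω hgood (right_ne_zero_of_mul hne)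
  refine ⟨by rw [map_mul]; exact mul_ne_zero h1 h3, ?_⟩
  simp only [map_mul, map_add, ← h2, ← h4]
  ring

lemma mul (hF : Ident DV DLV F) (hG : Ident DV DLV G) :
    Ident DV DLV (fun Λ Γ ω => F Λ Γ ω * G Λ Γ ω) := by
  obtain ⟨p, q, g, hg, H⟩ := hF
  obtain ⟨p', q', g', hg', H'⟩ := hG
  refine ⟨p * p', q * q', g * g', mul_ne_zero hg hg', fun Λ Γ ω hgood hne => ?_⟩
  rw [map_mul] at hne
  obtain ⟨h1, h2⟩ := H Λ Γ ω hgood (left_ne_zero_of_mul hne)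
  obtain ⟨h3, h4⟩ := H' Λ Γ ω hgood (right_ne_zero_of_mul hne)
  refine ⟨by rw [map_mul]; exact mul_ne_zero h1 h3, ?_⟩
  simp only [map_mul, ← h2, ← h4]
  ring

lemma sub (hF : Ident DV DLV F) (hG : Ident DV DLV G) :
    Ident DV DLV (fun Λ Γ ω => F Λ Γ ω - G Λ Γ ω) :=
  (hF.add ((const (-1)).mul hG)).congr fun Λ Γ ω _ => by ring

lemma sum {ι : Type*} (s : Finset ι) {F : ι → Matrix V V ℝ → Matrix L V ℝ → (V → ℝ) → ℝ}
    (hF : ∀ i ∈ s, Ident DV DLV (F i)) :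
    Ident DV DLV (fun Λ Γ ω => ∑ i ∈ s, F i Λ Γ ω) := by
  induction s using Finset.induction_on with
  | empty => simpa using const 0
  | insert a s ha ih =>
    simp only [Finset.sum_insert ha]
    exact (hF a (by simp)).add (ih fun i hi => hF i (by simp [hi]))

lemma prod {ι : Type*} (s : Finset ι) {F : ι → Matrix V V ℝ → Matrix L V ℝ → (V → ℝ) → ℝ}
    (hF : ∀ i ∈ s, Ident DV DLV (F i)) :
    Ident DV DLV (fun Λ Γ ω => ∏ i ∈ s, F i Λ Γ ω) := by
  induction s using Finset.induction_on with
  | empty => simpa using const 1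
  | insert a s ha ih =>
    simp only [Finset.prod_insert ha]
    exact (hF a (by simp)).mul (ih fun i hi => hF i (by simp [hi]))

lemma matrix_mul {m n k : Type*} [Fintype n]
    {A : Matrix V V ℝ → Matrix L V ℝ → (V → ℝ) → Matrix m n ℝ}
    {B : Matrix V V ℝ → Matrix L V ℝ → (V → ℝ) → Matrix n k ℝ} {i : m} {j : k}
    (hA : ∀ a, Ident DV DLV (fun Λ Γ ω => A Λ Γ ω i a))
    (hB : ∀ a, Ident DV DLV (fun Λ Γ ω => B Λ Γ ω a j)) :
    Ident DV DLV (fun Λ Γ ω => (A Λ Γ ω * B Λ Γ ω) i j) := by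
  simp only [Matrix.mul_apply]
  exact sum _ fun a _ => (hA a).mul (hB a)

lemma det {n : Type*} [Fintype n] [DecidableEq n]
    {A : Matrix V V ℝ → Matrix L V ℝ → (V → ℝ) → Matrix n n ℝ}
    (hA : ∀ a b, Ident DV DLV (fun Λ Γ ω => A Λ Γ ω a b)) :
    Ident DV DLV (fun Λ Γ ω => (A Λ Γ ω).det) := by
  simp only [Matrix.det_apply']
  exact sum _ fun σ _ => (const _).mul (prod _ fun a _ => hA _ _)

/-- Division by a generically nonzero identifiable function. -/
lemma of_mul_eq (hF : Ident DV DLV F) (hG : Ident DV DLV G)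
    {g : MvPolynomial (ParamVar DV DLV) ℝ} (hg : g ≠ 0)
    (h : ∀ Λ Γ ω, GoodParams DV DLV Λ Γ ω →
      MvPolynomial.eval (evalParam DV DLV Λ Γ ω) g ≠ 0 →
      G Λ Γ ω ≠ 0 ∧ X Λ Γ ω * G Λ Γ ω = F Λ Γ ω) : Ident DV DLV X := by
  obtain ⟨p, q, f, hf, H⟩ := hF
  obtain ⟨p', q', f', hf', H'⟩ := hG
  refine ⟨p * q', p' * q, g * (f * f'), mul_ne_zero hg (mul_ne_zero hf hf'),
    fun Λ Γ ω hgood hne => ?_⟩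
  rw [map_mul, map_mul] at hne
  obtain ⟨h1, h2⟩ := H Λ Γ ω hgood (left_ne_zero_of_mul (right_ne_zero_of_mul hne))
  obtain ⟨h3, h4⟩ := H' Λ Γ ω hgood (right_ne_zero_of_mul (right_ne_zero_of_mul hne))
  obtain ⟨h5, h6⟩ := h Λ Γ ω hgood (left_ne_zero_of_mul hne)
  simp only [map_mul, ← h2, ← h4]
  exact ⟨mul_ne_zero (mul_ne_zero h5 h3) h1, by rw [← h6]; ring⟩

end Ident

section Generic

variable {V L : Type*} (DV : Finset (V × V)) (DLV : Finset (L × V))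

/-- The matrix `Λ` with indeterminate entries. -/
noncomputable def genLam : Matrix V V (MvPolynomial (ParamVar DV DLV) ℝ) := fun a b =>
  if h : (a, b) ∈ DV then MvPolynomial.X (Sum.inl ⟨(a, b), h⟩) else 0

/-- The matrix `Γ` with indeterminate entries. -/
noncomputable def genGam : Matrix L V (MvPolynomial (ParamVar DV DLV) ℝ) := fun a b =>
  if h : (a, b) ∈ DLV then MvPolynomial.X (Sum.inr (Sum.inl ⟨(a, b), h⟩)) else 0

/-- The diagonal of `Ω_diag` with indeterminate entries. -/
noncomputable def genOm : V → MvPolynomial (ParamVar DV DLV) ℝ := fun a =>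
  MvPolynomial.X (Sum.inr (Sum.inr a))

variable {DV DLV}

/-- The parameter coordinates of matrices over an arbitrary ring. -/
def paramVal {S : Type*} (Λ : Matrix V V S) (Γ : Matrix L V S) (ω : V → S) :
    ParamVar DV DLV → S :=
  Sum.elim (fun e => Λ e.1.1 e.1.2) (Sum.elim (fun e => Γ e.1.1 e.1.2) ω)

lemma paramVal_eq_evalParam [DecidableEq V] [DecidableEq L]
    (Λ : Matrix V V ℝ) (Γ : Matrix L V ℝ) (ω : V → ℝ) :
    paramVal Λ Γ ω = evalParam DV DLV Λ Γ ω := by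
  funext x
  rcases x with x | x | x <;> rfl

variable {S : Type*} [CommRing S] [Algebra ℝ S]
  {Λ : Matrix V V S} {Γ : Matrix L V S} {ω : V → S}

lemma map_genLam (hΛ : ∀ a b, (a, b) ∉ DV → Λ a b = 0) :
    (genLam DV DLV).map (MvPolynomial.aeval (paramVal (DV := DV) (DLV := DLV) Λ Γ ω)) = Λ := by
  ext a b
  by_cases h : (a, b) ∈ DV
  · simp [genLam, h, paramVal]
  · simp [genLam, h, hΛ a b h]

lemma map_genGam (hΓ : ∀ a b, (a, b) ∉ DLV → Γ a b = 0) :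
    (genGam DV DLV).map (MvPolynomial.aeval (paramVal (DV := DV) (DLV := DLV) Λ Γ ω)) = Γ := by
  ext a b
  by_cases h : (a, b) ∈ DLV
  · simp [genGam, h, paramVal]
  · simp [genGam, h, hΓ a b h]

lemma map_genOm (a : V) :
    MvPolynomial.aeval (paramVal (DV := DV) (DLV := DLV) Λ Γ ω) (genOm DV DLV a) = ω a := by
  simp [genOm, paramVal]

end Generic

section SelCols

variable {V L T : Type*} [DecidableEq V] {S : Type*} [CommRing S]

/-- The matrix whose column `b` is the column `s b` of `1 - Λ` if `P b` holds, and of the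
identity matrix otherwise. -/
noncomputable def selCols (s : T → V) (P : T → Prop) (Λ : Matrix V V S) : Matrix V T S :=
  Matrix.of fun u b => if P b then (1 - Λ) u (s b) else (1 : Matrix V V S) u (s b)

lemma mul_selCols [Fintype V] {m : Type*} (A : Matrix m V S) (s : T → V) (P : T → Prop)
    (Λ : Matrix V V S) (i : m) (b : T) :
    (A * selCols s P Λ) i b = if P b then (A * (1 - Λ) : Matrix m V S) i (s b) else A i (s b) := by
  by_cases h : P b
  · simp [selCols, Matrix.mul_apply, h]
  · simp [selCols, Matrix.mul_apply, h, Matrix.one_apply]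

lemma selCols_zero (s : T → V) (P : T → Prop) (u : V) (b : T) :
    selCols s P (0 : Matrix V V S) u b = if u = s b then 1 else 0 := by
  simp [selCols, Matrix.one_apply]

lemma map_selCols {S' : Type*} [CommRing S'] (φ : S →+* S') (s : T → V) (P : T → Prop)
    (Λ : Matrix V V S) : (selCols s P Λ).map φ = selCols s P (Λ.map φ) := by
  ext u b
  by_cases h : P b <;> by_cases h' : u = s b <;> simp [selCols, h, h', Matrix.one_apply]

variable [Fintype V] [Fintype L]

/-- The polynomial version of the coefficient matrix of the linear system for the direct effects,
obtained by clearing the denominators of `(1 - Λ)⁻¹`. -/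
noncomputable def polySystem (src tgt : T → V) (P Q : T → Prop) (Λ : Matrix V V S)
    (Γ : Matrix L V S) (ω : V → S) : Matrix T T S :=
  ((1 - Λ).adjugate * selCols src P Λ)ᵀ * (Matrix.diagonal ω + Γᵀ * Γ) *
    ((1 - Λ).adjugate * selCols tgt Q Λ)

lemma map_adjugate_mul_selCols {S' : Type*} [CommRing S'] (φ : S →+* S') (s : T → V)
    (P : T → Prop) (Λ : Matrix V V S) :
    ((1 - Λ).adjugate * selCols s P Λ).map φ =
      (1 - Λ.map φ).adjugate * selCols s P (Λ.map φ) := by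
  have h : (1 - Λ).adjugate.map φ = (1 - Λ.map φ).adjugate := by
    have := φ.map_adjugate (1 - Λ)
    rwa [map_sub, map_one] at this
  rw [Matrix.map_mul, map_selCols, h]

lemma map_polySystem {S' : Type*} [CommRing S'] (φ : S →+* S') (src tgt : T → V)
    (P Q : T → Prop) (Λ : Matrix V V S) (Γ : Matrix L V S) (ω : V → S) :
    (polySystem src tgt P Q Λ Γ ω).map φ =
      polySystem src tgt P Q (Λ.map φ) (Γ.map φ) (fun a => φ (ω a)) := by
  have h : (Matrix.diagonal ω + Γᵀ * Γ).map φ =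
      Matrix.diagonal (fun a => φ (ω a)) + (Γ.map φ)ᵀ * Γ.map φ := by
    rw [Matrix.map_add _ (map_add φ), Matrix.map_mul, Matrix.diagonal_map (map_zero φ),
      Matrix.transpose_map]
  rw [polySystem, Matrix.map_mul, Matrix.map_mul, h, map_adjugate_mul_selCols,
    Matrix.transpose_map, map_adjugate_mul_selCols, polySystem]

lemma polySystem_of_factor [Fintype T] (src tgt : T → V) (P Q : T → Prop) (Λ : Matrix V V S)
    (Γ : Matrix L V S) (ω : V → S) (B : Matrix T V S)
    (h : Matrix.diagonal ω + Γᵀ * Γ = Bᵀ * B) :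
    polySystem src tgt P Q Λ Γ ω = (B * ((1 - Λ).adjugate * selCols src P Λ))ᵀ *
      (B * ((1 - Λ).adjugate * selCols tgt Q Λ)) := by
  simp only [polySystem, h, Matrix.transpose_mul, Matrix.mul_assoc]

lemma polySystem_eq_smul (src tgt : T → V) (P Q : T → Prop) (Λ : Matrix V V ℝ)
    (Γ : Matrix L V ℝ) (ω : V → ℝ) (hΛ : IsUnit (1 - Λ)) :
    polySystem src tgt P Q Λ Γ ω = ((1 - Λ).det ^ 2) •
      ((selCols src P Λ)ᵀ * SigmaMat Λ Γ ω * selCols tgt Q Λ) := by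
  have hdet : (1 - Λ).det ≠ 0 := ((Matrix.isUnit_iff_isUnit_det _).1 hΛ).ne_zero
  have hadj : (1 - Λ).adjugate = (1 - Λ).det • (1 - Λ)⁻¹ := by
    rw [Matrix.inv_def, Ring.inverse_eq_inv', smul_smul, mul_inv_cancel₀ hdet, one_smul]
  rw [polySystem, SigmaMat, hadj, ← Matrix.transpose_nonsing_inv, pow_two]
  simp only [Matrix.transpose_mul, Matrix.transpose_smul, Matrix.smul_mul, Matrix.mul_smul,
    smul_smul, Matrix.mul_assoc]

end SelCols

end LFG

namespace LFG

section PathMatrix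

lemma idxOf_getElem_le {α : Type*} [DecidableEq α] {l : List α} {n : ℕ} (h : n < l.length) :
    l.idxOf l[n] ≤ n := by
  by_contra! hlt
  simpa using List.not_of_lt_findIdx (p := (· == l[n])) hlt

variable {V T : Type*} [DecidableEq V] {path : T → List V} {start : T → V}

/-- The weight matrix that joins every node of each list, except the first one, to the
predecessor of its first occurrence. -/
noncomputable def pathMat (path : T → List V) : Matrix V V ℝ := Matrix.of fun u j =>
  if ∃ b n, j ∈ path b ∧ (path b).idxOf j = n + 1 ∧ (path b)[n]? = some u then 1 else 0

lemma pathMat_support {DV : Finset (V × V)}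
    (hchain : ∀ b, (path b).IsChain fun a c => (a, c) ∈ DV) (u j : V) (h : (u, j) ∉ DV) :
    pathMat path u j = 0 := by
  rw [pathMat, Matrix.of_apply, if_neg]
  rintro ⟨b, n, hj, hn, hu⟩
  refine h ?_
  have hlt : n + 1 < (path b).length := hn ▸ List.idxOf_lt_length_iff.2 hj
  have hc := List.isChain_iff_getElem.1 (hchain b) n hlt
  have h1 : (path b)[n + 1] = j := by
    have := List.getElem_idxOf (List.idxOf_lt_length_iff.2 hj)
    simpa only [hn] using this
  have h2 : (path b)[n] = u := by
    rw [List.getElem?_eq_getElem (by omega)] at hu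
    exact Option.some_injective _ hu
  rwa [h1, h2] at hc

variable [Fintype V]

lemma vecMul_pathMat_of_notMem (x : V → ℝ) {j : V} (h : ∀ b, j ∉ path b) :
    (x ᵥ* pathMat path) j = 0 := by
  refine Finset.sum_eq_zero fun u _ => ?_
  refine mul_eq_zero_of_right (x u) (if_neg ?_)
  rintro ⟨b, n, hj, -⟩
  exact h b hj

variable (hdisj : ∀ b b' j, j ∈ path b → j ∈ path b' → b = b')
include hdisj

lemma vecMul_pathMat_of_idxOf_eq_zero (x : V → ℝ) {j : V} {b : T} (hj : j ∈ path b)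
    (h0 : (path b).idxOf j = 0) : (x ᵥ* pathMat path) j = 0 := by
  refine Finset.sum_eq_zero fun u _ => ?_
  refine mul_eq_zero_of_right (x u) (if_neg ?_)
  rintro ⟨b', n, hj', hn, -⟩
  obtain rfl := hdisj _ _ _ hj hj'
  omega

lemma vecMul_pathMat_of_idxOf_eq_succ (x : V → ℝ) {j u : V} {b : T} {n : ℕ} (hj : j ∈ path b)
    (hn : (path b).idxOf j = n + 1) (hu : (path b)[n]? = some u) :
    (x ᵥ* pathMat path) j = x u := by
  have h : ∀ u', pathMat path u' j = if u' = u then 1 else 0 := by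
    intro u'
    rw [pathMat, Matrix.of_apply]
    refine if_congr ⟨?_, ?_⟩ rfl rfl
    · rintro ⟨b', n', hj', hn', hu'⟩
      obtain rfl := hdisj _ _ _ hj hj'
      obtain rfl : n = n' := by omega
      exact Option.some_injective _ (hu'.symm.trans hu)
    · rintro rfl
      exact ⟨b, n, hj, hn, hu⟩
  simp [Matrix.vecMul, dotProduct, h]

lemma det_one_sub_pathMat_ne_zero : (1 - pathMat path).det ≠ 0 := by
  intro h
  obtain ⟨x, hx, hx0⟩ := Matrix.exists_vecMul_eq_zero_iff.2 h
  rw [Matrix.vecMul_sub, Matrix.vecMul_one, sub_eq_zero] at hx0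
  refine hx (funext fun j => ?_)
  by_cases hj : ∃ b, j ∈ path b
  · obtain ⟨b, hj⟩ := hj
    suffices H : ∀ n j, j ∈ path b → (path b).idxOf j ≤ n → x j = 0 from H _ j hj le_rfl
    intro n
    induction n with
    | zero =>
      intro j hj hn
      rw [hx0, vecMul_pathMat_of_idxOf_eq_zero hdisj x hj (by omega)]
    | succ n ih =>
      intro j hj hn
      rcases hm : (path b).idxOf j with _ | m
      · exact ih j hj (by omega)
      · have hlt : m < (path b).length := by
          have := List.idxOf_lt_length_iff.2 hj
          omega
        rw [hx0, vecMul_pathMat_of_idxOf_eq_succ hdisj x hj hm (List.getElem?_eq_getElem hlt)]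
        exact ih _ (List.getElem_mem hlt) ((idxOf_getElem_le hlt).trans (by omega))
  · push Not at hj
    rw [hx0, vecMul_pathMat_of_notMem x hj, Pi.zero_apply]

/-- The indicator vectors of the lists are mapped by `1 - pathMat path` to the indicator vectors
of their first nodes. -/
lemma indicator_mul_one_sub_pathMat (hstart : ∀ b, (path b).head? = some (start b)) (b : T)
    (j : V) :
    ((Matrix.of fun b j => if j ∈ path b then 1 else 0 : Matrix T V ℝ) *
      (1 - pathMat path) : Matrix T V ℝ) b j = if j = start b then 1 else 0 := by
  set X : Matrix T V ℝ := Matrix.of fun b j => if j ∈ path b then 1 else 0 with hX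
  have hXb : ∀ b j, X b j = if j ∈ path b then 1 else 0 := fun b j => rfl
  have hmul : (X * pathMat path) b j = (X b ᵥ* pathMat path) j := rfl
  have hmem : ∀ b, start b ∈ path b := fun b => List.mem_of_mem_head? (hstart b)
  rw [Matrix.mul_sub, Matrix.mul_one, Matrix.sub_apply, hmul]
  by_cases hj : ∃ b, j ∈ path b
  · obtain ⟨b', hj⟩ := hj
    have hzero : (path b').idxOf j = 0 ↔ j = start b' := by
      have := hstart b'
      cases hp : path b' with
      | nil => simp [hp] at hj
      | cons a l =>
        rw [hp] at this
        simp only [List.head?_cons, Option.some.injEq] at this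
        subst this
        by_cases h : j = start b'
        · simp [h]
        · simp [List.idxOf_cons, h, beq_false_of_ne (Ne.symm h)]
    have hb : j ∈ path b ↔ b = b' := ⟨fun h => hdisj _ _ _ h hj, fun h => h ▸ hj⟩
    rcases hm : (path b').idxOf j with _ | m
    · rw [vecMul_pathMat_of_idxOf_eq_zero hdisj _ hj hm, sub_zero, hXb]
      refine if_congr ?_ rfl rfl
      rw [hb]
      constructor
      · rintro rfl
        exact hzero.1 hm
      · rintro rfl
        exact hdisj _ _ _ (hmem b) hj
    · have hlt : m < (path b').length := by
        have := List.idxOf_lt_length_iff.2 hj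
        omega
      rw [vecMul_pathMat_of_idxOf_eq_succ hdisj _ hj hm (List.getElem?_eq_getElem hlt), hXb, hXb]
      have hb' : (path b')[m] ∈ path b ↔ b = b' :=
        ⟨fun h => hdisj _ _ _ h (List.getElem_mem hlt), fun h => h ▸ List.getElem_mem hlt⟩
      rw [if_congr hb rfl rfl, if_congr hb' rfl rfl, sub_self, if_neg]
      rintro rfl
      obtain rfl := hdisj _ _ _ (hmem b) hj
      exact absurd (hzero.2 rfl) (by omega)
  · push Not at hj
    rw [vecMul_pathMat_of_notMem _ hj, hXb, if_neg (hj b), if_neg, sub_zero]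
    rintro rfl
    exact hj b (hmem b)

end PathMatrix

end LFG

namespace LFG

section Nondegenerate

variable {V L T : Type*} [DecidableEq V]

/-- The matrix whose row `b` is the row `h` of `Γ` if `lat b = some h`, and the unit vector at
`src b` if `lat b = none`. -/
def factorMat {S : Type*} [CommRing S] (src : T → V) (lat : T → Option L) (Γ : Matrix L V S) :
    Matrix T V S := Matrix.of fun b a =>
  (lat b).elim (if a = src b then 1 else 0) fun h => Γ h a

lemma map_factorMat {S S' : Type*} [CommRing S] [CommRing S'] (φ : S →+* S') (src : T → V)
    (lat : T → Option L) (Γ : Matrix L V S) :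
    (factorMat src lat Γ).map φ = factorMat src lat (Γ.map φ) := by
  ext b a
  rcases h : lat b with _ | l <;> simp [factorMat, h, apply_ite φ]

lemma factorMat_indicator {S : Type*} [CommRing S] {src pos : T → V} {lat : T → Option L}
    {Γ : Matrix L V S} (hΓ : ∀ b h a, lat b = some h → Γ h a = if a = pos b then 1 else 0)
    (hnone : ∀ b, lat b = none → pos b = src b) (b : T) (a : V) :
    factorMat src lat Γ b a = if a = pos b then 1 else 0 := by
  rcases h : lat b with _ | l
  · simp [factorMat, h, hnone b h]
  · simp only [factorMat, h, Matrix.of_apply, Option.elim]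
    exact hΓ b l a h

variable [Fintype L] [Fintype T]

lemma diagonal_add_eq_factorMat {S : Type*} [CommRing S] {src : T → V} {lat : T → Option L}
    (hlat : ∀ b b' h, lat b = some h → lat b' = some h → b = b') (Γ : Matrix L V S) :
    Matrix.diagonal (fun a => ∑ b, if lat b = none ∧ src b = a then (1 : S) else 0) +
      (Matrix.of fun h a => if ∃ b, lat b = some h then Γ h a else 0 : Matrix L V S)ᵀ *
        (Matrix.of fun h a => if ∃ b, lat b = some h then Γ h a else 0 : Matrix L V S) =
      (factorMat src lat Γ)ᵀ * factorMat src lat Γ := by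
  ext a a'
  have h1 : ∀ h, (if ∃ b, lat b = some h then Γ h a else 0) *
      (if ∃ b, lat b = some h then Γ h a' else 0) =
      ∑ b, if lat b = some h then Γ h a * Γ h a' else 0 := by
    intro h
    by_cases hb : ∃ b, lat b = some h
    · obtain ⟨b, hb⟩ := hb
      have : ∀ b', lat b' = some h ↔ b' = b :=
        fun b' => ⟨fun h' => hlat _ _ _ h' hb, fun h' => h' ▸ hb⟩
      simp [this]
    · push Not at hb
      simp [hb]
  have h2 : Matrix.diagonal (fun a => ∑ b, if lat b = none ∧ src b = a then (1 : S) else 0) a a' =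
      ∑ b, if lat b = none ∧ src b = a ∧ src b = a' then (1 : S) else 0 := by
    by_cases haa : a = a'
    · subst haa
      simp
    · rw [Matrix.diagonal_apply_ne _ haa]
      refine (Finset.sum_eq_zero fun b _ => if_neg ?_).symm
      rintro ⟨-, h, h'⟩
      exact haa (h.symm.trans h')
  rw [Matrix.add_apply, h2, Matrix.mul_apply, Matrix.mul_apply]
  simp only [Matrix.transpose_apply, Matrix.of_apply, h1]
  rw [Finset.sum_comm, ← Finset.sum_add_distrib]
  refine Finset.sum_congr rfl fun b _ => ?_
  rcases h : lat b with _ | l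
  · have ha : a = src b ↔ src b = a := eq_comm
    have ha' : a' = src b ↔ src b = a' := eq_comm
    simp only [factorMat, h, Matrix.of_apply, Option.elim, ha, ha', true_and]
    split_ifs <;> simp_all
  · simp [factorMat, h]

variable [Fintype V]

/-- The determinant of the polynomial system does not vanish if its rows and columns are joined
by half-treks without sided intersection. -/
lemma det_polySystem_ne_zero [DecidableEq T] {DV : Finset (V × V)} {DLV : Finset (L × V)}
    {src tgt start : T → V} {lat : T → Option L} {path : T → List V} {P Q : T → Prop}
    (hsrc : Function.Injective src)
    (hlat : ∀ b b' h, lat b = some h → lat b' = some h → b = b')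
    (hlatsrc : ∀ b h, lat b = some h → (h, src b) ∈ DLV)
    (hlatstart : ∀ b h, lat b = some h → (h, start b) ∈ DLV)
    (hnone : ∀ b, lat b = none → start b = src b)
    (hchain : ∀ b, (path b).IsChain fun a c => (a, c) ∈ DV)
    (hdisj : ∀ b b' j, j ∈ path b → j ∈ path b' → b = b')
    (hstart : ∀ b, (path b).head? = some (start b))
    (htgt : ∀ b, tgt b ∈ path b)
    (hQ : ∀ b, Q b → start b = tgt b) :
    (polySystem src tgt P Q (genLam DV DLV) (genGam DV DLV) (genOm DV DLV)).det ≠ 0 := by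
  set R := MvPolynomial (ParamVar DV DLV) ℝ
  set Γ' : Matrix L V R := Matrix.of fun h a =>
    if ∃ b, lat b = some h then genGam DV DLV h a else 0 with hΓ'
  set ω' : V → R := fun a => ∑ b, if lat b = none ∧ src b = a then 1 else 0
  set φ : R →+* R := (MvPolynomial.aeval (paramVal (genLam DV DLV) Γ' ω')).toRingHom
  suffices h : φ (polySystem src tgt P Q (genLam DV DLV) (genGam DV DLV)
      (genOm DV DLV)).det ≠ 0 from fun h0 => h (by rw [h0, map_zero])
  have hmapΛ : (genLam DV DLV).map φ = genLam DV DLV :=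
    map_genLam fun a b h => by simp [genLam, h]
  have hmapΓ : (genGam DV DLV).map φ = Γ' :=
    map_genGam fun a b h => by simp [hΓ', genGam, h]
  have hmapω : (fun a => φ (genOm DV DLV a)) = ω' := funext fun a => map_genOm a
  rw [RingHom.map_det, RingHom.mapMatrix_apply, map_polySystem, hmapΛ, hmapΓ, hmapω,
    polySystem_of_factor _ _ _ _ _ _ _ _ (diagonal_add_eq_factorMat hlat (genGam DV DLV)),
    Matrix.det_mul, Matrix.det_transpose]
  have hspec : ∀ (pos s : T → V) (P : T → Prop) (Λ₀ : Matrix V V ℝ),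
      (∀ a b, (a, b) ∉ DV → Λ₀ a b = 0) →
      (∀ b h, lat b = some h → (h, pos b) ∈ DLV) →
      (∀ b, lat b = none → pos b = src b) →
      ((Matrix.of fun b a => if a = pos b then 1 else 0 : Matrix T V ℝ) *
        ((1 - Λ₀).adjugate * selCols s P Λ₀)).det ≠ 0 →
      (factorMat src lat (genGam DV DLV) *
        ((1 - genLam DV DLV).adjugate * selCols s P (genLam DV DLV))).det ≠ 0 := by
    intro pos s P Λ₀ hΛ₀ hpos hposnone hne h0
    set Γ₀ : Matrix L V ℝ := Matrix.of fun h a =>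
      if ∃ b, lat b = some h ∧ pos b = a then (1 : ℝ) else 0 with hΓ₀
    set ψ : R →+* ℝ := (MvPolynomial.aeval (paramVal Λ₀ Γ₀ fun _ => (0 : ℝ))).toRingHom
    have hmapΛ : (genLam DV DLV).map ψ = Λ₀ := map_genLam hΛ₀
    have hmapΓ : (genGam DV DLV).map ψ = Γ₀ := map_genGam fun h a hha => by
      rw [hΓ₀, Matrix.of_apply, if_neg]
      rintro ⟨b, hb, rfl⟩
      exact hha (hpos b h hb)
    have := congrArg ψ h0
    rw [map_zero, RingHom.map_det, RingHom.mapMatrix_apply, Matrix.map_mul,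
      map_adjugate_mul_selCols, map_factorMat, hmapΛ, hmapΓ] at this
    refine hne ?_
    convert this using 3
    ext b a
    refine (factorMat_indicator (fun b h a hb => ?_) hposnone b a).symm
    refine if_congr ⟨?_, fun h' => ⟨b, hb, h'.symm⟩⟩ rfl rfl
    rintro ⟨b', hb', rfl⟩
    rw [hlat _ _ _ hb hb']
  refine mul_ne_zero ?_ ?_
  · refine hspec src src P 0 (by simp) hlatsrc (fun _ _ => rfl) ?_
    have : ((Matrix.of fun b a => if a = src b then 1 else 0 : Matrix T V ℝ) *
        ((1 - 0 : Matrix V V ℝ).adjugate * selCols src P (0 : Matrix V V ℝ))) = 1 := by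
      ext b b'
      rw [sub_zero, Matrix.adjugate_one, Matrix.one_mul, Matrix.mul_apply]
      simp [selCols_zero, Matrix.one_apply, hsrc.eq_iff, eq_comm]
    rw [this, Matrix.det_one]
    exact one_ne_zero
  · refine hspec start tgt Q (pathMat path) (fun a b => pathMat_support hchain a b)
      hlatstart hnone ?_
    set I : Matrix T V ℝ := Matrix.of fun b j => if j ∈ path b then 1 else 0 with hI
    have hIM : (Matrix.of fun b a => if a = start b then 1 else 0 : Matrix T V ℝ) =
        I * (1 - pathMat path) := by
      ext b a
      exact (indicator_mul_one_sub_pathMat hdisj hstart b a).symm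
    have hone : I * selCols tgt Q (pathMat path) = 1 := by
      ext b b'
      have hmem : tgt b' ∈ path b ↔ b = b' :=
        ⟨fun h => hdisj _ _ _ h (htgt b'), fun h => h ▸ htgt b⟩
      rw [mul_selCols, Matrix.one_apply]
      split_ifs with hq hb hb
      · rw [← hIM, Matrix.of_apply, if_pos]
        rw [hb, hQ b' hq]
      · rw [← hIM, Matrix.of_apply, if_neg]
        intro h
        exact hb (hmem.1 (h ▸ List.mem_of_mem_head? (hstart b)))
      · exact if_pos (hmem.2 hb)
      · exact if_neg fun h => hb (hmem.1 h)
    rw [hIM, Matrix.mul_assoc, ← Matrix.mul_assoc (1 - pathMat path), Matrix.mul_adjugate,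
      Matrix.smul_mul, Matrix.one_mul, Matrix.mul_smul, hone, Matrix.det_smul, Matrix.det_one,
      mul_one]
    exact pow_ne_zero _ (det_one_sub_pathMat_ne_zero hdisj)

end Nondegenerate

end LFG

namespace LFG

section LinearSystem

variable {V L : Type*} [DecidableEq V]

lemma mul_selCols_mulVec [Fintype V] {m : Type*} {Z A : Finset V} (hZA : Disjoint Z A)
    (N : Matrix m V ℝ) (Λ : Matrix V V ℝ) (ψ φ : V → ℝ) (t : m) :
    ((N * selCols (Subtype.val : {x // x ∈ Z ∪ A} → V) (fun b => b.1 ∈ Z) Λ) *ᵥ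
      fun b => if b.1 ∈ Z then ψ b else φ b) t =
      ∑ z ∈ Z, (N * (1 - Λ) : Matrix m V ℝ) t z * ψ z + ∑ p ∈ A, N t p * φ p := by
  simp only [Matrix.mulVec, dotProduct, mul_selCols]
  refine (Finset.sum_congr rfl fun b _ => ?_).trans ((Finset.sum_coe_sort (Z ∪ A) fun b =>
    (if b ∈ Z then (N * (1 - Λ) : Matrix m V ℝ) t b else N t b) *
      if b ∈ Z then ψ b else φ b).trans ?_)
  · by_cases hb : b.1 ∈ Z <;> simp [hb]
  rw [Finset.sum_union hZA]
  congr 1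
  · exact Finset.sum_congr rfl fun z hz => by simp [hz]
  · refine Finset.sum_congr rfl fun p hp => ?_
    have : p ∉ Z := Finset.disjoint_right.1 hZA hp
    simp [this]

/-- Cramer's rule for the direct effects on `v`. -/
lemma mul_det_eq_det_updateCol [Fintype V] {Z A : Finset V} {H : Finset L} {v : V}
    (hZA : Disjoint Z A) (hcard : Z.card = H.card) (Λ : Matrix V V ℝ) (Γ : Matrix L V ℝ)
    (hΛ : ∀ u, u ∉ A → Λ u v = 0) (N : Matrix {x // x ∈ Z ∪ A} V ℝ)
    (κ : {x // x ∈ Z ∪ A} → L → ℝ)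
    (hN : ∀ b, ∀ x ∈ insert v Z,
      (N * (1 - Λ) : Matrix {x // x ∈ Z ∪ A} V ℝ) b x = ∑ h ∈ H, κ b h * Γ h x)
    (hdet : (N * selCols (Subtype.val : {x // x ∈ Z ∪ A} → V) (fun b => b.1 ∈ Z) Λ).det ≠ 0)
    (w : {x // x ∈ Z ∪ A}) (hw : w.1 ∈ A) :
    Λ w v * (N * selCols (Subtype.val : {x // x ∈ Z ∪ A} → V) (fun b => b.1 ∈ Z) Λ).det =
      ((N * selCols (Subtype.val : {x // x ∈ Z ∪ A} → V) (fun b => b.1 ∈ Z) Λ).updateCol w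
        fun b => N b v).det := by
  set M := N * selCols (Subtype.val : {x // x ∈ Z ∪ A} → V) (fun b => b.1 ∈ Z) Λ with hM
  have hsum : ∀ (ψ : V → ℝ) b,
      ∑ z ∈ Z, (N * (1 - Λ) : Matrix {x // x ∈ Z ∪ A} V ℝ) b z * ψ z =
        ∑ h ∈ H, κ b h * ∑ z ∈ Z, Γ h z * ψ z := by
    intro ψ b
    simp only [Finset.mul_sum]
    rw [Finset.sum_comm]
    refine Finset.sum_congr rfl fun z hz => ?_
    rw [hN b z (Finset.mem_insert_of_mem hz), Finset.sum_mul]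
    exact Finset.sum_congr rfl fun h _ => mul_assoc _ _ _
  let extend : ({z // z ∈ Z} → ℝ) → V → ℝ := fun ψ x => if hx : x ∈ Z then ψ ⟨x, hx⟩ else 0
  let f := Matrix.mulVecLin (Matrix.of fun (h : {h // h ∈ H}) (z : {z // z ∈ Z}) => Γ h z)
  have hf : ∀ ψ h, f ψ h = ∑ z ∈ Z, Γ h z * extend ψ z := by
    intro ψ h
    rw [← Finset.sum_coe_sort]
    simp [f, extend, Matrix.mulVec, dotProduct]
  have hinj : Function.Injective f := by
    rw [← LinearMap.ker_eq_bot, LinearMap.ker_eq_bot']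
    intro ψ hψ
    have hzero := Matrix.eq_zero_of_mulVec_eq_zero hdet
      (v := fun b => if b.1 ∈ Z then extend ψ b else 0) (funext fun t => by
        rw [hM, mul_selCols_mulVec hZA N Λ (extend ψ) (fun _ => 0), hsum]
        simp only [mul_zero, Finset.sum_const_zero, add_zero, Pi.zero_apply]
        refine Finset.sum_eq_zero fun h hh => ?_
        rw [← hf ψ ⟨h, hh⟩, hψ, Pi.zero_apply, mul_zero])
    funext z
    have := congrFun hzero ⟨z, Finset.mem_union_left _ z.2⟩
    simpa [extend] using this
  have hsurj : Function.Surjective f :=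
    (LinearMap.injective_iff_surjective_of_finrank_eq_finrank (by simp [hcard])).1 hinj
  obtain ⟨ψ, hψ⟩ := hsurj fun h => Γ h v
  have hsol : (M *ᵥ fun b => if b.1 ∈ Z then extend ψ b else Λ b v) = fun b => N b v := by
    funext b
    rw [hM, mul_selCols_mulVec hZA N Λ (extend ψ) (fun u => Λ u v), hsum]
    have h1 : ∑ h ∈ H, κ b h * ∑ z ∈ Z, Γ h z * extend ψ z =
        (N * (1 - Λ) : Matrix {x // x ∈ Z ∪ A} V ℝ) b v := by
      rw [hN b v (Finset.mem_insert_self _ _)]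
      refine Finset.sum_congr rfl fun h hh => ?_
      rw [← hf ψ ⟨h, hh⟩, hψ]
    have h2 : ∑ p ∈ A, N b p * Λ p v = (N * Λ) b v := by
      rw [Matrix.mul_apply]
      exact Finset.sum_subset (Finset.subset_univ _) fun u _ hu => by rw [hΛ u hu, mul_zero]
    rw [h1, h2, Matrix.mul_sub, Matrix.mul_one, Matrix.sub_apply, sub_add_cancel]
  rw [← hsol, ← Matrix.cramer_apply, Matrix.cramer_eq_adjugate_mulVec, Matrix.mulVec_mulVec,
    Matrix.adjugate_mul, Matrix.smul_mulVec, Matrix.one_mulVec, Pi.smul_apply, smul_eq_mul,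
    if_neg (Finset.disjoint_right.1 hZA hw), mul_comm]

end LinearSystem

section HalfTreks

variable {V L : Type*} [DecidableEq V] [DecidableEq L] {DV : Finset (V × V)}
  {DLV : Finset (L × V)}

/-- The inverse of `1 - Λ` vanishes at pairs of nodes that are not joined by a directed path. -/
lemma inv_one_sub_apply_eq_zero [Fintype V] {Λ : Matrix V V ℝ}
    (hΛ : ∀ a b, (a, b) ∉ DV → Λ a b = 0) (hreg : IsUnit (1 - Λ)) {u y : V}
    (h : ¬ Relation.ReflTransGen (fun a b => (a, b) ∈ DV) u y) : (1 - Λ)⁻¹ u y = 0 := by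
  set r := Relation.ReflTransGen (fun a b : V => (a, b) ∈ DV)
  have htri : (1 - Λ).BlockTriangular fun a => if r u a then 1 else 0 := by
    intro a b hab
    have ha : r u a := by
      by_contra ha
      simp [ha] at hab
    have hb : ¬ r u b := by
      intro hb
      simp [ha, hb] at hab
    have hne : a ≠ b := by
      rintro rfl
      exact hb ha
    rw [Matrix.sub_apply, Matrix.one_apply_ne hne, hΛ a b fun hab => hb (ha.tail hab), sub_zero]
  let _ := hreg.invertible
  refine Matrix.blockTriangular_inv_of_blockTriangular htri ?_
  have : r u u := Relation.ReflTransGen.refl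
  simp [this, h]

omit [DecidableEq V] [DecidableEq L] in
lemma htrFrom_of_reflTransGen {H : Finset L} {x y : V} (hne : x ≠ y)
    (h : Relation.ReflTransGen (fun a b => (a, b) ∈ DV) x y) : HtrFrom DV DLV H x y := by
  obtain ⟨l, hl, hlast⟩ := List.exists_isChain_cons_of_relationReflTransGen h
  rw [List.isChain_cons] at hl
  refine ⟨hne, ⟨x, none, l, hl.2, fun _ => hl.1, by simp, by simp⟩, rfl, ?_,
    by simp [HalfTrek.Avoids]⟩
  rw [← hlast, HalfTrek.target, List.getLast_eq_getLastD]

omit [DecidableEq V] [DecidableEq L] in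
lemma htrFrom_of_latent {H : Finset L} {h : L} {x u y : V} (hne : x ≠ y) (hh : h ∉ H)
    (hx : (h, x) ∈ DLV) (hu : (h, u) ∈ DLV)
    (hr : Relation.ReflTransGen (fun a b => (a, b) ∈ DV) u y) : HtrFrom DV DLV H x y := by
  obtain ⟨l, hl, hlast⟩ := List.exists_isChain_cons_of_relationReflTransGen hr
  refine ⟨hne, ⟨x, some h, u :: l, hl, by simp, by simpa using hx, by simpa using hu⟩, rfl, ?_,
    by simpa [HalfTrek.Avoids] using hh⟩
  rw [← hlast, HalfTrek.target, List.getLast_eq_getLastD, List.getLastD_cons]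

variable [Fintype V] [Fintype L]

/-- After multiplication by the rows selected according to half-trek reachability, the columns of
`Ω` at `v` and `Z` factor through the latent nodes in `H`. -/
lemma selCols_mul_sigma_factor {T : Type*} {v : V} {Y Z : Finset V} {H : Finset L} {src : T → V}
    (hsrc : ∀ b, src b ∈ Y) (hY : Disjoint Y (insert v Z))
    (hlat : paL DLV Y ∩ paL DLV (insert v Z) ⊆ H)
    {Λ : Matrix V V ℝ} {Γ : Matrix L V ℝ} {ω : V → ℝ} (hgood : GoodParams DV DLV Λ Γ ω)
    (b : T) {x : V} (hx : x ∈ insert v Z) :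
    ((selCols src (fun b => HtrReach DV DLV H (insert v Z) (src b)) Λ)ᵀ * SigmaMat Λ Γ ω *
      (1 - Λ) : Matrix T V ℝ) b x =
      ∑ h ∈ H, (Γ * ((1 - Λ)⁻¹ *
        selCols src (fun b => HtrReach DV DLV H (insert v Z) (src b)) Λ)) h b * Γ h x := by
  obtain ⟨hΛ, hreg, hΓ, -⟩ := hgood
  have hdet : IsUnit (1 - Λ).det := (Matrix.isUnit_iff_isUnit_det _).1 hreg
  set C := selCols src (fun b => HtrReach DV DLV H (insert v Z) (src b)) Λ with hC
  set K : Matrix V T ℝ := (1 - Λ)⁻¹ * C with hK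
  have hne : ∀ b, src b ≠ x := fun b h => Finset.disjoint_left.1 hY (hsrc b) (h ▸ hx)
  have hmul : (Cᵀ * SigmaMat Λ Γ ω * (1 - Λ) : Matrix T V ℝ) =
      Kᵀ * (Matrix.diagonal ω + Γᵀ * Γ) := by
    rw [SigmaMat, ← Matrix.transpose_nonsing_inv, hK, Matrix.transpose_mul]
    simp only [Matrix.mul_assoc, Matrix.nonsing_inv_mul _ hdet, Matrix.mul_one]
  have hKb : ∀ u, K u b ≠ 0 → u ≠ x ∧ ∀ h ∉ H, Γ h u * Γ h x = 0 := by
    intro u hu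
    by_cases hr : HtrReach DV DLV H (insert v Z) (src b)
    · have hub : u = src b := by
        by_contra hub
        refine hu ?_
        rw [hK, hC, mul_selCols, if_pos hr, Matrix.nonsing_inv_mul _ hdet,
          Matrix.one_apply_ne hub]
      subst hub
      refine ⟨hne b, fun h hh => ?_⟩
      by_contra h0
      refine hh (hlat ?_)
      simp only [paL, Finset.mem_inter, Finset.mem_image, Finset.mem_filter]
      exact ⟨⟨(h, src b), ⟨not_imp_comm.1 (hΓ h _) (left_ne_zero_of_mul h0), hsrc b⟩, rfl⟩,
        ⟨(h, x), ⟨not_imp_comm.1 (hΓ h _) (right_ne_zero_of_mul h0), hx⟩, rfl⟩⟩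
    · have hpath : Relation.ReflTransGen (fun a b => (a, b) ∈ DV) u (src b) := by
        by_contra hp
        refine hu ?_
        rw [hK, hC, mul_selCols, if_neg hr, inv_one_sub_apply_eq_zero hΛ hreg hp]
      refine ⟨?_, fun h hh => ?_⟩
      · rintro rfl
        exact hr ⟨u, hx, htrFrom_of_reflTransGen (hne b).symm hpath⟩
      · by_contra h0
        exact hr ⟨x, hx, htrFrom_of_latent (hne b).symm hh
          (not_imp_comm.1 (hΓ h _) (right_ne_zero_of_mul h0))
          (not_imp_comm.1 (hΓ h _) (left_ne_zero_of_mul h0)) hpath⟩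
  rw [hmul, Matrix.mul_apply]
  simp only [Matrix.mul_apply (M := Γ), Finset.sum_mul]
  rw [Finset.sum_comm]
  refine Finset.sum_congr rfl fun u _ => ?_
  by_cases hu : K u b = 0
  · simp [hu]
  obtain ⟨hux, hH⟩ := hKb u hu
  rw [Matrix.transpose_apply, Matrix.add_apply, Matrix.diagonal_apply_ne _ hux, zero_add,
    Matrix.mul_apply]
  simp only [Matrix.transpose_apply]
  rw [← Finset.sum_subset (Finset.subset_univ H) fun h _ hh => hH h hh,
    Finset.mul_sum]
  exact Finset.sum_congr rfl fun h _ => by ring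

end HalfTreks

end LFG

namespace LFG

section Identification

variable {V L : Type*} [DecidableEq V] [DecidableEq L] {DV : Finset (V × V)}
  {DLV : Finset (L × V)}

lemma mem_paV {v w : V} : w ∈ paV DV v ↔ (w, v) ∈ DV := by
  simp [paV]

/-- The list of the observed nodes on the right-hand side of a half-trek. -/
def HalfTrek.path (t : HalfTrek DV DLV) : List V :=
  t.latent.elim (t.source :: t.tail) fun _ => t.tail

/-- The first observed node on the right-hand side of a half-trek. -/
def HalfTrek.start (t : HalfTrek DV DLV) : V := t.path.head?.getD t.source

namespace HalfTrek

variable (t : HalfTrek DV DLV)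

omit [DecidableEq V] [DecidableEq L] in
lemma start_of_latent_eq_none (h : t.latent = none) : t.start = t.source := by
  simp [start, path, h]

omit [DecidableEq V] [DecidableEq L] in
lemma path_head? : t.path.head? = some t.start := by
  rcases h : t.latent with _ | l
  · simp [start, path, h]
  · obtain ⟨x, hx, -⟩ := t.latent_head l h
    simp [start, path, h, hx]

omit [DecidableEq V] [DecidableEq L] in
lemma latent_start {l : L} (h : t.latent = some l) : (l, t.start) ∈ DLV := by
  obtain ⟨x, hx, hlx⟩ := t.latent_head l h
  simpa [start, path, h, hx] using hlx

omit [DecidableEq V] [DecidableEq L] in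
lemma isChain_path : t.path.IsChain fun a c => (a, c) ∈ DV := by
  rcases h : t.latent with _ | l
  · simp only [path, h, Option.elim, List.isChain_cons]
    exact ⟨t.src_edge h, t.chain⟩
  · simp only [path, h, Option.elim]
    exact t.chain

omit [DecidableEq L] in
lemma mem_path_iff {x : V} : x ∈ t.path ↔ x ∈ t.rightV := by
  rcases h : t.latent with _ | l <;> simp [path, rightV, h]

omit [DecidableEq V] [DecidableEq L] in
lemma target_mem_path : t.target ∈ t.path := by
  rcases h : t.latent with _ | l
  · rw [target, path, h, Option.elim, ← List.getLast_eq_getLastD (List.cons_ne_nil _ _)]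
    exact List.getLast_mem _
  · obtain ⟨x, hx, -⟩ := t.latent_head l h
    rw [target, path, h, Option.elim]
    cases htail : t.tail with
    | nil => simp [htail] at hx
    | cons a s =>
      rw [List.getLastD_cons, ← List.getLast_eq_getLastD (List.cons_ne_nil _ _)]
      exact List.getLast_mem _

end HalfTrek

variable [Fintype V] [Fintype L]

omit [DecidableEq L] in
lemma Ident.selCols {T : Type*} {s : T → V} {P : T → Prop} {b : T}
    (h : P b → ∀ u, Ident DV DLV fun Λ _ _ => Λ u (s b)) (u : V) :
    Ident DV DLV fun Λ _ _ => selCols s P Λ u b := by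
  by_cases hb : P b
  · refine ((Ident.const ((1 : Matrix V V ℝ) u (s b))).sub (h hb u)).congr fun Λ _ _ _ => ?_
    simp [LFG.selCols, hb]
  · refine (Ident.const ((1 : Matrix V V ℝ) u (s b))).congr fun Λ _ _ _ => ?_
    simp [LFG.selCols, hb]

/-- If the direct effects on `Z` and on the half-trek reachable part of `Y` are identifiable,
then so are the direct effects on `v`. -/
lemma SatisfiesLFHTC.ident {v : V} {Y Z : Finset V} {H : Finset L}
    (hcrit : SatisfiesLFHTC DV DLV v Y Z H)
    (hprev : ∀ a, (a ∈ Z ∨ (a ∈ Y ∧ HtrReach DV DLV H (insert v Z) a)) →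
      ∀ u, Ident DV DLV fun Λ _ _ => Λ u a) (w : V) :
    Ident DV DLV fun Λ _ _ => Λ w v := by
  obtain ⟨-, -, -, hcard, hZA, hY, hlat, f, ⟨htarget, himage, hnsi⟩, hZ⟩ := hcrit
  by_cases hw : w ∈ paV DV v
  swap
  · exact (Ident.const 0).congr fun Λ _ _ hgood => hgood.1 _ _ fun h => hw (mem_paV.2 h)
  set A := paV DV v
  let T := {x // x ∈ Z ∪ A}
  let src : T → V := fun b => (f b).source
  let P : T → Prop := fun b => HtrReach DV DLV H (insert v Z) (src b)
  let Q : T → Prop := fun b => b.1 ∈ Z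
  have hsrcY : ∀ b, src b ∈ Y := fun b => himage ▸ Finset.mem_image_of_mem _ b.2
  have hnsi' : ∀ b b' : T, b ≠ b' → NSI (f b) (f b') := fun b b' hb =>
    hnsi b b.2 b' b'.2 fun h => hb (Subtype.ext h)
  have hgen : (polySystem src Subtype.val P Q (genLam DV DLV) (genGam DV DLV)
      (genOm DV DLV)).det ≠ 0 := by
    refine det_polySystem_ne_zero (src := src) (start := fun b => (f b).start)
      (lat := fun b => (f b).latent) (path := fun b => (f b).path) ?_ ?_
      (fun b => (f b).latent_src) (fun b h => (f b).latent_start)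
      (fun b => (f b).start_of_latent_eq_none) (fun b => (f b).isChain_path) ?_
      (fun b => (f b).path_head?) (fun b => ?_) ?_
    · intro b b' hbb
      by_contra hne
      have := (hnsi' b b' hne).1
      simp only [HalfTrek.leftV, Finset.disjoint_singleton] at this
      exact this hbb
    · intro b b' h hb hb'
      by_contra hne
      exact Finset.disjoint_left.1 (hnsi' b b' hne).2.1
        (show h ∈ (f b).lats by simp [HalfTrek.lats, hb]) (by simp [HalfTrek.lats, hb'])
    · intro b b' j hb hb'
      by_contra hne
      exact Finset.disjoint_left.1 (hnsi' b b' hne).2.2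
        ((HalfTrek.mem_path_iff _).1 hb) ((HalfTrek.mem_path_iff _).1 hb')
    · have := (f b).target_mem_path
      rwa [htarget b b.2] at this
    · intro b hb
      obtain ⟨h, -, hlat, htail⟩ := hZ b hb
      simp [HalfTrek.start, HalfTrek.path, hlat, htail]
  have hdet : ∀ Λ Γ ω, GoodParams DV DLV Λ Γ ω →
      MvPolynomial.eval (evalParam DV DLV Λ Γ ω) (polySystem src Subtype.val P Q
        (genLam DV DLV) (genGam DV DLV) (genOm DV DLV)).det ≠ 0 →
      ((selCols src P Λ)ᵀ * SigmaMat Λ Γ ω * selCols Subtype.val Q Λ).det ≠ 0 := by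
    intro Λ Γ ω hgood hne h0
    refine hne ?_
    set φ : MvPolynomial (ParamVar DV DLV) ℝ →+* ℝ :=
      (MvPolynomial.aeval (paramVal Λ Γ ω)).toRingHom with hφ
    have hmapΛ : (genLam DV DLV).map φ = Λ := map_genLam hgood.1
    have hmapΓ : (genGam DV DLV).map φ = Γ := map_genGam hgood.2.2.1
    have hmapω : (fun a => φ (genOm DV DLV a)) = ω := funext fun a => map_genOm a
    have heval : MvPolynomial.eval (evalParam DV DLV Λ Γ ω) = φ := by
      rw [← paramVal_eq_evalParam, hφ, ← MvPolynomial.coe_aeval_eq_eval]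
      rfl
    rw [heval, RingHom.map_det, RingHom.mapMatrix_apply, map_polySystem, hmapΛ, hmapΓ, hmapω,
      polySystem_eq_smul _ _ _ _ _ _ _ hgood.2.1, Matrix.det_smul, h0, mul_zero]
  have hN : ∀ b a, Ident DV DLV fun Λ Γ ω => ((selCols src P Λ)ᵀ * SigmaMat Λ Γ ω) b a :=
    fun b a => Ident.matrix_mul
      (fun u => Ident.selCols (fun hb => hprev _ (Or.inr ⟨hsrcY b, hb⟩)) u)
      fun u => Ident.sigma u a
  have hM : ∀ b b', Ident DV DLV fun Λ Γ ω =>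
      ((selCols src P Λ)ᵀ * SigmaMat Λ Γ ω * selCols Subtype.val Q Λ) b b' :=
    fun b b' => Ident.matrix_mul (hN b) fun u =>
      Ident.selCols (P := Q) (b := b') (fun hb => hprev _ (Or.inl hb)) u
  have hwT : w ∈ Z ∪ A := Finset.mem_union_right _ hw
  refine Ident.of_mul_eq (F := fun Λ Γ ω =>
    (((selCols src P Λ)ᵀ * SigmaMat Λ Γ ω * selCols Subtype.val Q Λ).updateCol ⟨w, hwT⟩
      fun b => ((selCols src P Λ)ᵀ * SigmaMat Λ Γ ω) b v).det)
    (Ident.det fun b b' => ?_) (Ident.det hM) hgen fun Λ Γ ω hgood hne => ?_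
  · simp only [Matrix.updateCol_apply]
    split_ifs
    · exact hN b v
    · exact hM b b'
  · have h0 := hdet Λ Γ ω hgood hne
    refine ⟨h0, mul_det_eq_det_updateCol hZA hcard Λ Γ
      (fun u hu => hgood.1 _ _ fun h => hu (mem_paV.2 h)) _ _
      (fun b x hx => selCols_mul_sigma_factor hsrcY hY hlat hgood b hx) h0 ⟨w, hwT⟩ hw⟩

omit [DecidableEq L] in
/-- The latent covariance matrix is recovered from the direct effects. -/
lemma diagonal_add_eq_of_goodParams {Λ : Matrix V V ℝ} {Γ : Matrix L V ℝ} {ω : V → ℝ}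
    (h : GoodParams DV DLV Λ Γ ω) :
    Matrix.diagonal ω + Γᵀ * Γ = (1 - Λ)ᵀ * SigmaMat Λ Γ ω * (1 - Λ) := by
  have hdet : IsUnit (1 - Λ).det := (Matrix.isUnit_iff_isUnit_det _).1 h.2.1
  have hdet' : IsUnit (1 - Λ)ᵀ.det := by rwa [Matrix.det_transpose]
  rw [SigmaMat, Matrix.mul_assoc, Matrix.nonsing_inv_mul_cancel_right _ _ hdet,
    Matrix.mul_nonsing_inv_cancel_left _ _ hdet']

end Identification

end LFG

/-- **Rational identifiability of LF-HTC-identifiable graphs.**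
If there is an enumeration `v_1, …, v_d` of the observed nodes together with triples
`(Y_i, Z_i, H_i)` satisfying the LF-HTC with respect to `v_i` such that
`Z_i ∪ (Y_i ∩ htr_{H_i}(Z_i ∪ {v_i}))` only contains earlier nodes, then every edge of
`D_V` is rationally identifiable and every entry of the latent covariance matrix
`Ω = Ω_diag + Γᵀ Γ` is recoverable by a rational formula in `Σ` generically. -/
theorem lfhtc_identifiable_graph_is_rationally_identifiable
    {V L : Type} [Fintype V] [DecidableEq V] [Fintype L] [DecidableEq L]
    (DV : Finset (V × V)) (DLV : Finset (L × V))
    (hloop : ∀ x : V, (x, x) ∉ DV)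
    (e : Fin (Fintype.card V) ≃ V)
    (Ys Zs : Fin (Fintype.card V) → Finset V)
    (Hs : Fin (Fintype.card V) → Finset L)
    (hcrit : ∀ i, SatisfiesLFHTC DV DLV (e i) (Ys i) (Zs i) (Hs i))
    (hord : ∀ i (w : V),
      (w ∈ Zs i ∨ (w ∈ Ys i ∧ HtrReach DV DLV (Hs i) (insert (e i) (Zs i)) w)) →
      ∃ j, j < i ∧ e j = w) :
    (∀ p ∈ DV, RatIdent DV DLV p.1 p.2) ∧ (∀ i j : V, OmegaIdent DV DLV i j) := by
  have hΛ : ∀ i w, Ident DV DLV fun Λ _ _ => Λ w (e i) := by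
    intro i
    induction i using WellFoundedLT.induction with
    | ind i ih =>
      refine (hcrit i).ident fun a ha => ?_
      obtain ⟨j, hj, rfl⟩ := hord i a ha
      exact ih j hj
  have hΛ' : ∀ w v, Ident DV DLV fun Λ _ _ => Λ w v := by
    intro w v
    obtain ⟨i, rfl⟩ := e.surjective v
    exact hΛ i w
  have hsub : ∀ w v, Ident DV DLV fun Λ _ _ => (1 - Λ) w v := fun w v =>
    (Ident.const ((1 : Matrix V V ℝ) w v)).sub (hΛ' w v)
  refine ⟨fun p _ => hΛ' p.1 p.2, fun i j => ?_⟩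
  have hΩ : Ident DV DLV fun Λ Γ ω =>
      ((1 - Λ)ᵀ * SigmaMat Λ Γ ω * (1 - Λ) : Matrix V V ℝ) i j :=
    Ident.matrix_mul (fun a => Ident.matrix_mul (fun b => hsub b i) fun b => Ident.sigma b a)
      fun a => hsub a j
  exact hΩ.congr (G := fun _ Γ ω => (Matrix.diagonal ω + Γᵀ * Γ) i j)
    fun Λ Γ ω hgood => congrFun (congrFun (diagonal_add_eq_of_goodParams hgood) i) j
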